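/- arXiv:1203.2484 — 2 statements merged into one kernel-verified Lean document; each statement's English description precedes it below -/
import Mathlib

section
/- Let (R,M,k) be a regular local ring with regular system of parameters (y,u_1,...,u_d) and f ∈ M with f ∉ (u_1,...,u_d). Then the F-subset Δ(f;u_1,...,u_d;y) does not depend on the chosen finite unit-coefficient expansion of f — equivalently, the smallest F-subset containing the projected support is the same for every finite expansion f = Σ C_{a,b} y^b u^a with unit coefficients — and Δ(f;u_1,...,u_d;y) is a rational polyhedron. -/
/-!
Characteristic polyhedra of singularities without completion
(V. Cossart, O. Piltant), formalized statements.
-/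

noncomputable section

open IsLocalRing TensorProduct

namespace CharPolyhedra

universe u v

/-! ### Polyhedral notions -/

/-- The nonnegative orthant in `ℝ^d`. -/
def orthant (d : ℕ) : Set (Fin d → ℝ) := {x | ∀ i, 0 ≤ x i}

/-- An `F`-subset of `ℝ_{≥0}^d`: a closed convex subset stable under translation
by the nonnegative orthant. -/
def IsFSubset {d : ℕ} (Δ : Set (Fin d → ℝ)) : Prop :=
  Δ ⊆ orthant d ∧ IsClosed Δ ∧ Convex ℝ Δ ∧ ∀ v ∈ Δ, ∀ w ∈ orthant d, v + w ∈ Δ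

/-- The smallest `F`-subset containing a given set of points. -/
def smallestFSubset {d : ℕ} (X : Set (Fin d → ℝ)) : Set (Fin d → ℝ) :=
  ⋂₀ {Δ | IsFSubset Δ ∧ X ⊆ Δ}

/-- A vertex of an `F`-subset: a point cut out by a positive linear form. -/
def IsVertex {d : ℕ} (Δ : Set (Fin d → ℝ)) (v : Fin d → ℝ) : Prop :=
  ∃ L : Fin d → ℝ, (∀ i, 0 < L i) ∧ Δ ∩ {x | ∑ i, L i * x i = 1} = {v}

/-- A rational polyhedron: an `F`-subset cut out by finitely many nonnegative
rational linear forms. -/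
def IsRationalPolyhedron {d : ℕ} (Δ : Set (Fin d → ℝ)) : Prop :=
  ∃ (n : ℕ) (L : Fin n → Fin d → ℚ), (∀ j i, 0 ≤ L j i) ∧
    Δ = {x | x ∈ orthant d ∧ ∀ j, 1 ≤ ∑ i, (L j i : ℝ) * x i}

/-- `min {L(a) : a ∈ Δ}` for a linear form with rational coefficients `L`. -/
def ellOf {d : ℕ} (L : Fin d → ℚ) (Δ : Set (Fin d → ℝ)) : ℝ :=
  sInf ((fun x => ∑ i, (L i : ℝ) * x i) '' Δ)

/-! ### Regular local rings, systems of parameters -/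

/-- A family `s` of `n` elements is a regular system of parameters of the local
ring `R`: it generates the maximal ideal and `n` equals the Krull dimension. -/
def IsSysOfParams (R : Type u) [CommRing R] [IsLocalRing R] {n : ℕ} (s : Fin n → R) : Prop :=
  Ideal.span (Set.range s) = maximalIdeal R ∧ ringKrullDim R = n

/-- `(y, u 0, ..., u (d-1))` is a regular system of parameters of `R`. -/
def IsRSP (R : Type u) [CommRing R] [IsLocalRing R] {d : ℕ} (y : R) (u : Fin d → R) : Prop :=
  IsSysOfParams R (Fin.cons y u)

/-- A regular local ring: a Noetherian local ring whose maximal ideal is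
generated by a regular system of parameters. -/
def IsRegularLocalRing (R : Type u) [CommRing R] [IsLocalRing R] : Prop :=
  IsNoetherianRing R ∧ ∃ (n : ℕ) (s : Fin n → R), IsSysOfParams R s

/-- A regular ring: a Noetherian ring all of whose localizations at primes are
regular local rings. -/
def IsRegularRing (A : Type u) [CommRing A] : Prop :=
  IsNoetherianRing A ∧ ∀ (P : Ideal A) [P.IsPrime],
    IsRegularLocalRing (Localization.AtPrime P)

/-! ### Monomial expansions and polyhedra -/

variable {R : Type u} [CommRing R]

/-- The monomial `y^b u^a`, where `ab = (a, b)`. -/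
def monomial {d : ℕ} (y : R) (u : Fin d → R) (ab : (Fin d → ℕ) × ℕ) : R :=
  y ^ ab.2 * ∏ i, u i ^ ab.1 i

/-- A finite expansion `f = Σ_{(a,b)} C_{a,b} y^b u^a` with all coefficients units. -/
def IsUnitExpansion {d : ℕ} (f y : R) (u : Fin d → R)
    (c : ((Fin d → ℕ) × ℕ) →₀ R) : Prop :=
  (∀ ab ∈ c.support, IsUnit (c ab)) ∧ f = c.sum fun ab r => r * monomial y u ab

/-- The projection `(a, b) ↦ a / (m - b)` from the point `(0, m)`. -/
def projPoint {d : ℕ} (m : ℕ) (ab : (Fin d → ℕ) × ℕ) : Fin d → ℝ :=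
  fun i => (ab.1 i : ℝ) / ((m : ℝ) - (ab.2 : ℝ))

/-- The projected points attached to (the support of) an expansion. -/
def expPoints {d : ℕ} (m : ℕ) (s : Finset ((Fin d → ℕ) × ℕ)) : Set (Fin d → ℝ) :=
  {x | ∃ ab ∈ s, ab.2 < m ∧ x = projPoint m ab}

/-- The polyhedron `Δ(f; u; y)` computed with prescribed order `m`: the smallest
`F`-subset containing the projected supports of all finite unit-coefficient
expansions of `f` in the parameters `(y, u)`. -/
def DeltaOf {d : ℕ} (f y : R) (u : Fin d → R) (m : ℕ) : Set (Fin d → ℝ) :=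
  smallestFSubset (⋃ c ∈ {c | IsUnitExpansion f y u c}, expPoints m c.support)

/-- The order of the image of `f` in `R/(u_1, ..., u_d)`, i.e. the largest `n`
with `f ∈ M^n + (u_1, ..., u_d)`. -/
def ordRes {d : ℕ} [IsLocalRing R] (f : R) (u : Fin d → R) : ℕ :=
  sSup {n : ℕ | f ∈ (maximalIdeal R) ^ n ⊔ Ideal.span (Set.range u)}

/-- Hironaka's polyhedron `Δ(f; u_1, ..., u_d; y)`. -/
def Delta {d : ℕ} [IsLocalRing R] (f y : R) (u : Fin d → R) : Set (Fin d → ℝ) :=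
  DeltaOf f y u (ordRes f u)

/-! ### Completion and the characteristic polyhedron -/

/-- The `M`-adic completion `R̂` of a local ring `R`. -/
abbrev Completion (R : Type u) [CommRing R] [IsLocalRing R] : Type u :=
  AdicCompletion (maximalIdeal R) R

/-- The canonical map `R → R̂`. -/
def cmpl {R : Type u} [CommRing R] [IsLocalRing R] : R →+* Completion R :=
  algebraMap R (Completion R)

/-- `(ŷ, u_1, ..., u_d)` is a regular system of parameters of the completion
`R̂`: it generates the maximal ideal `M·R̂` of `R̂`. -/
def IsRSPhat (R : Type u) [CommRing R] [IsLocalRing R] {d : ℕ}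
    (yh : Completion R) (u : Fin d → R) : Prop :=
  Ideal.span (insert yh (Set.range fun i => cmpl (u i)))
    = (maximalIdeal R).map (cmpl (R := R))

/-- Hironaka's characteristic polyhedron `Δ(f; u_1, ..., u_d)`: the intersection
of the `Δ(f; u; ŷ)` over all regular systems of parameters `(ŷ, u_1, ..., u_d)`
of the completion `R̂`. -/
def CharPolyhedron {d : ℕ} [IsLocalRing R] (f : R) (u : Fin d → R) : Set (Fin d → ℝ) :=
  ⋂ yh ∈ {yh : Completion R | IsRSPhat R yh u},
    DeltaOf (cmpl f) yh (fun i => cmpl (u i)) (ordRes f u)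

/-! ### G-rings, excellence -/

/-- A `κ`-algebra `A` is geometrically regular if `κ' ⊗[κ] A` is a regular ring
for every finite field extension `κ'/κ`. -/
def IsGeometricallyRegularAlgebra (κ : Type u) [Field κ] (A : Type v) [CommRing A]
    [Algebra κ A] : Prop :=
  ∀ (κ' : Type u) [Field κ'] [Algebra κ κ'] [Module.Finite κ κ'],
    IsRegularRing (κ' ⊗[κ] A)

/-- A local ring has geometrically regular formal fibers if, for every prime
`P ⊂ R`, the formal fiber `κ(P) ⊗_R R̂` is a geometrically regular
`κ(P)`-algebra. -/
def HasGeomRegularFormalFibers (R : Type u) [CommRing R] [IsLocalRing R] : Prop :=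
  ∀ (P : Ideal R) [P.IsPrime],
    IsGeometricallyRegularAlgebra (ResidueField (Localization.AtPrime P))
      (ResidueField (Localization.AtPrime P) ⊗[R] Completion R)

/-- A G-ring: a Noetherian ring all of whose localizations at primes have
geometrically regular formal fibers. -/
def IsGRing (A : Type u) [CommRing A] : Prop :=
  IsNoetherianRing A ∧ ∀ (P : Ideal A) [P.IsPrime],
    HasGeomRegularFormalFibers (Localization.AtPrime P)

/-- A saturated chain of primes: each step is a covering relation. -/
def IsSaturatedChain {A : Type u} [CommRing A] (c : LTSeries (PrimeSpectrum A)) : Prop :=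
  ∀ i : Fin c.length, c.toFun i.castSucc ⋖ c.toFun i.succ

/-- A catenary ring: any two saturated chains of primes with the same endpoints
have the same length. -/
def IsCatenary (A : Type u) [CommRing A] : Prop :=
  ∀ (c₁ c₂ : LTSeries (PrimeSpectrum A)), c₁.head = c₂.head → c₁.last = c₂.last →
    IsSaturatedChain c₁ → IsSaturatedChain c₂ → c₁.length = c₂.length

/-- Universally catenary: all polynomial rings over `A` are catenary. -/
def IsUniversallyCatenary (A : Type u) [CommRing A] : Prop :=
  ∀ n : ℕ, IsCatenary (MvPolynomial (Fin n) A)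

/-- The regular locus of any domain finite over `A` is open. -/
def HasOpenRegularLocus (A : Type u) [CommRing A] : Prop :=
  ∀ (B : Type u) [CommRing B] [IsDomain B] [Algebra A B] [Module.Finite A B],
    IsOpen {P : PrimeSpectrum B | IsRegularLocalRing (Localization.AtPrime P.asIdeal)}

/-- Quasi-excellent: a G-ring with open regular loci for finite domains over it. -/
def IsQuasiExcellent (A : Type u) [CommRing A] : Prop :=
  IsGRing A ∧ HasOpenRegularLocus A

/-- Excellent: universally catenary and quasi-excellent. -/
def IsExcellent (A : Type u) [CommRing A] : Prop :=
  IsUniversallyCatenary A ∧ IsQuasiExcellent A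

/-! ### Monomial valuations and associated graded rings -/

/-- The weight `l·b + L(a)` of the monomial `y^b u^a`. -/
def weight {d : ℕ} (l : ℝ) (L : Fin d → ℝ) (ab : (Fin d → ℕ) × ℕ) : ℝ :=
  l * (ab.2 : ℝ) + ∑ i, L i * (ab.1 i : ℝ)

/-- The ideal `I_λ` generated by the monomials `y^b u^a` with `l·b + L(a) ≥ λ`. -/
def monIdeal {d : ℕ} (y : R) (u : Fin d → R) (l : ℝ) (L : Fin d → ℝ) (lam : ℝ) :
    Ideal R :=
  Ideal.span {g | ∃ ab : (Fin d → ℕ) × ℕ, g = monomial y u ab ∧ lam ≤ weight l L ab}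

/-- The monomial valuation `v(g) := max {λ : g ∈ I_λ}`. -/
def vval {d : ℕ} (y : R) (u : Fin d → R) (l : ℝ) (L : Fin d → ℝ) (g : R) : ℝ :=
  sSup {lam : ℝ | g ∈ monIdeal y u l L lam}

/-- The Rees algebra `⊕_λ I_λ` of the filtration `(I_λ)`, realized inside the
monoid algebra `R[ℝ]`. -/
def ReesAlgebra {d : ℕ} (y : R) (u : Fin d → R) (l : ℝ) (L : Fin d → ℝ) :
    Subalgebra R (AddMonoidAlgebra R ℝ) :=
  Algebra.adjoin R {p | ∃ (lam : ℝ) (x : R), x ∈ monIdeal y u l L lam ∧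
    p = AddMonoidAlgebra.single lam x}

/-- The ideal `⊕_λ I_{λ⁺}` of the Rees algebra. -/
def grIdeal {d : ℕ} (y : R) (u : Fin d → R) (l : ℝ) (L : Fin d → ℝ) :
    Ideal (ReesAlgebra y u l L) :=
  Ideal.span {p | ∃ (lam : ℝ) (x : R), (∃ lam' > lam, x ∈ monIdeal y u l L lam') ∧
    (p : AddMonoidAlgebra R ℝ) = AddMonoidAlgebra.single lam x}

/-- The associated graded ring `gr_v(R) = ⊕_λ I_λ / I_{λ⁺}` of `R` with respect
to the monomial valuation `v`, realized as `(⊕_λ I_λ) / (⊕_λ I_{λ⁺})`. -/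
abbrev GrRing {d : ℕ} (y : R) (u : Fin d → R) (l : ℝ) (L : Fin d → ℝ) : Type u :=
  ReesAlgebra y u l L ⧸ grIdeal y u l L

/-- `x ∈ gr_v(R)` is the initial form of `g ∈ R`: the class of `g` placed in
degree `v(g)`. -/
def IsInitialForm {d : ℕ} (y : R) (u : Fin d → R) (l : ℝ) (L : Fin d → ℝ) (g : R)
    (x : GrRing y u l L) : Prop :=
  ∃ h : AddMonoidAlgebra.single (vval y u l L g) g ∈ ReesAlgebra y u l L,
    x = Ideal.Quotient.mk (grIdeal y u l L)
      ⟨AddMonoidAlgebra.single (vval y u l L g) g, h⟩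

theorem dim_le_card {R : Type*} [CommRing R] [IsLocalRing R] [IsNoetherianRing R] (S : Finset R)
    (h : Ideal.span (S : Set R) = maximalIdeal R) : ringKrullDim R ≤ S.card := by
  refine (ringKrullDim_le_spanFinrank_maximalIdeal R).trans ?_
  rw [← h]
  have := Submodule.spanFinrank_span_le_ncard_of_finite (R := R) (s := (S : Set R)) S.finite_toSet
  rw [Set.ncard_coe_finset] at this
  exact_mod_cast this

theorem quot_aux {R : Type*} [CommRing R] [IsLocalRing R] [IsNoetherianRing R] {n : ℕ}
    (S T : Finset R) (h : Ideal.span ((S : Set R) ∪ T) = maximalIdeal R)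
    (hc : S.card + T.card ≤ n) (hd : ringKrullDim R = n) :
    ∃ _ : IsLocalRing (R ⧸ Ideal.span (T : Set R)), ∃ S' : Finset (R ⧸ Ideal.span (T : Set R)),
      S'.card ≤ S.card ∧ Ideal.span (S' : Set _) = maximalIdeal (R ⧸ Ideal.span (T : Set R)) ∧
      ringKrullDim (R ⧸ Ideal.span (T : Set R)) = S.card ∧ S.card + T.card = n := by
  classical
  have hT : (T : Set R) ⊆ maximalIdeal R := by
    rw [← h]; exact Set.subset_union_right.trans Ideal.subset_span
  have hne : Ideal.span (T : Set R) ≠ ⊤ := by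
    intro h1
    have := Ideal.span_le.2 hT
    rw [h1] at this
    exact (maximalIdeal.isMaximal R).ne_top (top_le_iff.1 this)
  have : Nontrivial (R ⧸ Ideal.span (T : Set R)) := Ideal.Quotient.nontrivial_iff.2 hne
  have hl : IsLocalRing (R ⧸ Ideal.span (T : Set R)) :=
    IsLocalRing.of_surjective' (Ideal.Quotient.mk _) Ideal.Quotient.mk_surjective
  refine ⟨hl, S.image (Ideal.Quotient.mk _), Finset.card_image_le, ?_⟩
  have h1 : Ideal.span ((S.image (Ideal.Quotient.mk (Ideal.span (T : Set R))) : Finset _) : Set _)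
      = maximalIdeal (R ⧸ Ideal.span (T : Set R)) := by
    rw [← IsLocalRing.map_maximalIdeal_of_surjective (Ideal.Quotient.mk (Ideal.span (T : Set R)))
      Ideal.Quotient.mk_surjective, ← h, Ideal.span_union, Ideal.map_sup, Ideal.map_quotient_self,
      sup_bot_eq, Ideal.map_span, Finset.coe_image]
  have h2 : ringKrullDim (R ⧸ Ideal.span (T : Set R)) ≤ S.card :=
    (dim_le_card _ h1).trans (by exact_mod_cast Finset.card_image_le)
  have h3 := ringKrullDim_le_ringKrullDim_quotient_add_card T
    (by rwa [IsLocalRing.ringJacobson_eq_maximalIdeal])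
  rw [hd] at h3
  refine ⟨h1, ?_⟩
  have h4 : (0 : WithBot ℕ∞) ≤ ringKrullDim (R ⧸ Ideal.span (T : Set R)) :=
    ringKrullDim_nonneg_of_nontrivial
  generalize ringKrullDim (R ⧸ Ideal.span (T : Set R)) = D at *
  induction D using WithBot.recBotCoe with
  | bot => simp at h4
  | coe D =>
    induction D using WithTop.recTopCoe with
    | top =>
      exfalso
      have : ((⊤ : ℕ∞) : WithBot ℕ∞) ≤ ((S.card : ℕ∞) : WithBot ℕ∞) := h2
      rw [WithBot.coe_le_coe] at this
      simp at this
    | coe D =>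
      have h2' : ((D : ℕ) : WithBot ℕ∞) ≤ (S.card : ℕ) := h2
      have h3' : ((n : ℕ) : WithBot ℕ∞) ≤ ((D : ℕ) : WithBot ℕ∞) + (T.card : ℕ) := h3
      have h2'' : D ≤ S.card := by exact_mod_cast h2'
      have h3'' : n ≤ D + T.card := by exact_mod_cast h3'
      have e : D = S.card := by omega
      refine ⟨?_, by omega⟩
      rw [e]; rfl

theorem isDomain_of_regular (n : ℕ) : ∀ (R : Type u) [CommRing R] [IsLocalRing R]
    [IsNoetherianRing R] (S : Finset R), S.card ≤ n →
    Ideal.span (S : Set R) = maximalIdeal R → ringKrullDim R = n → IsDomain R := by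
  classical
  induction n with
  | zero =>
    intro R _ _ _ S hS hs hd
    have : S = ∅ := by simpa using hS
    subst this
    have hf : IsField R := by
      rw [IsLocalRing.isField_iff_maximalIdeal_eq, ← hs]; simp
    exact hf.isDomain
  | succ n ih =>
    intro R _ _ _ S hS hs hd
    have hfin := minimalPrimes.finite_of_isNoetherianRing R
    have hMfg : (maximalIdeal R).FG := IsNoetherian.noetherian _
    have hav : ¬ ((maximalIdeal R : Set R) ⊆
        ⋃ i ∈ (↑(insert (maximalIdeal R ^ 2) hfin.toFinset) : Set (Ideal R)), ((id i : Ideal R) : Set R)) := by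
      rw [Ideal.subset_union_prime (maximalIdeal R ^ 2) (maximalIdeal R ^ 2)]
      · rintro ⟨i, hi, hle⟩
        rw [Finset.mem_insert] at hi
        rcases hi with rfl | hi
        · have := Submodule.eq_bot_of_le_smul_of_le_jacobson_bot (maximalIdeal R) (maximalIdeal R)
            hMfg (by simpa [pow_two] using hle)
            (by rw [IsLocalRing.jacobson_eq_maximalIdeal _ bot_ne_top])
          have := ringKrullDim_eq_zero_of_isField (IsLocalRing.isField_iff_maximalIdeal_eq.2 this)
          rw [hd] at this
          have h' : n + 1 = 0 := by exact_mod_cast this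
          omega
        · have hi' : i ∈ minimalPrimes R := by simpa using hi
          have hip : i.IsPrime := hi'.1.1
          have : maximalIdeal R = i := le_antisymm hle (IsLocalRing.le_maximalIdeal hip.ne_top)
          subst this
          have hh := IsLocalRing.maximalIdeal_height_eq_ringKrullDim (R := R)
          rw [Ideal.height_eq_zero_iff.2 hi', hd] at hh
          have h' : 0 = n + 1 := by exact_mod_cast hh
          omega
      · intro i hi h1 _
        rw [Finset.mem_insert] at hi
        have hi' : i ∈ minimalPrimes R := by simpa [h1] using hi
        exact hi'.1.1
    rw [Set.not_subset] at hav
    obtain ⟨x, hxM, hx⟩ := hav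
    simp only [Set.mem_iUnion, not_exists] at hx
    have hx2 : x ∉ maximalIdeal R ^ 2 := hx _ (by simp)
    have hxP : ∀ P ∈ minimalPrimes R, x ∉ P := fun P hP => hx P (by simp [hP])
    have hxM' := hxM
    rw [SetLike.mem_coe, ← hs] at hxM'
    obtain ⟨r, -, hr⟩ := Submodule.mem_span_finset.1 hxM'
    have hSM : ∀ a ∈ S, a ∈ maximalIdeal R := fun a ha => by
      rw [← hs]; exact Ideal.subset_span ha
    obtain ⟨a, haS, ha⟩ : ∃ a ∈ S, IsUnit (r a) := by
      by_contra hcon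
      push Not at hcon
      apply hx2
      rw [← hr, pow_two]
      refine Ideal.sum_mem _ fun a ha => ?_
      exact Ideal.mul_mem_mul ((IsLocalRing.mem_maximalIdeal _).2 (hcon a ha)) (hSM a ha)
    have hspan : Ideal.span (((S.erase a : Finset R) : Set R) ∪ ({x} : Finset R)) = maximalIdeal R := by
      apply le_antisymm
      · rw [Ideal.span_le]
        rintro z (hz | hz)
        · exact hSM z (Finset.mem_of_mem_erase hz)
        · have : z = x := by simpa using hz
          rw [this]; exact hxM
      · conv_lhs => rw [← hs]
        rw [Ideal.span_le]
        intro z hz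
        by_cases hza : z = a
        · subst hza
          rw [← Finset.add_sum_erase _ _ haS] at hr
          have : r z * z = x - ∑ b ∈ S.erase z, r b • b := by rw [← hr]; simp
          rw [SetLike.mem_coe, ← Ideal.unit_mul_mem_iff_mem _ ha, this]
          refine Ideal.sub_mem _ (Ideal.subset_span (Or.inr (by simp))) ?_
          refine Ideal.sum_mem _ fun b hb => Ideal.mul_mem_left _ _ (Ideal.subset_span (Or.inl hb))
        · exact Ideal.subset_span (Or.inl (Finset.mem_erase.2 ⟨hza, hz⟩))
    have hcard : (S.erase a).card + ({x} : Finset R).card ≤ n + 1 := by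
      rw [Finset.card_erase_of_mem haS, Finset.card_singleton]; omega
    obtain ⟨_, S', hS', hs', hd', hcc⟩ := quot_aux (S.erase a) {x} hspan hcard hd
    have hn : (S.erase a).card = n := by simpa using hcc
    rw [hn] at hS' hd'
    have hdom := ih _ S' hS' hs' hd'
    rw [Ideal.Quotient.isDomain_iff_prime] at hdom
    obtain ⟨P, hP, hPx⟩ := Ideal.exists_minimalPrimes_le (I := (⊥ : Ideal R)) (J := Ideal.span (({x} : Finset R) : Set R)) bot_le
    have hPp : P.IsPrime := hP.1.1
    have hxnP := hxP P hP
    have : P = ⊥ := by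
      refine Submodule.eq_bot_of_le_smul_of_le_jacobson_bot (maximalIdeal R) P
        (IsNoetherian.noetherian _) ?_ (by rw [IsLocalRing.jacobson_eq_maximalIdeal _ bot_ne_top])
      intro p hp
      have hp' := hPx hp
      rw [Finset.coe_singleton, Ideal.mem_span_singleton] at hp'
      obtain ⟨q, rfl⟩ := hp'
      exact Ideal.mul_mem_mul hxM ((hPp.mem_or_mem hp).resolve_left hxnP)
    subst this
    exact IsDomain.of_bot_isPrime R

/-- The ideal generated by the `x j ^ (a j + 1)`, `j ∈ T`. -/
def powIdeal {R : Type*} [CommRing R] {ι : Type*} (x : ι → R) (a : ι → ℕ) (T : Finset ι) : Ideal R :=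
  Ideal.span ((fun j => x j ^ (a j + 1)) '' (T : Set ι))

section
variable {R : Type u} [CommRing R] {ι : Type*} [DecidableEq ι]

theorem powIdeal_insert (x : ι → R) (a : ι → ℕ) (T : Finset ι) (j : ι) :
    powIdeal x a (insert j T) = Ideal.span {x j ^ (a j + 1)} ⊔ powIdeal x a T := by
  rw [powIdeal, powIdeal, Finset.coe_insert, Set.image_insert_eq, Ideal.span_insert]

theorem powIdeal_congr (x : ι → R) (a a' : ι → ℕ) (T : Finset ι) (h : ∀ j ∈ T, a j = a' j) :
    powIdeal x a T = powIdeal x a' T := by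
  rw [powIdeal, powIdeal]
  congr 1
  apply Set.image_congr
  intro j hj
  rw [h j hj]

theorem powIdeal_zero (x : ι → R) (a : ι → ℕ) (T : Finset ι) (h : ∀ j ∈ T, a j = 0) :
    powIdeal x a T = Ideal.span (x '' T) := by
  rw [powIdeal]
  congr 1
  apply Set.image_congr
  intro j hj
  simp [h j hj]

theorem nzd_step (I : Ideal R) (z x : R) (k : ℕ)
    (h1 : ∀ w, z * w ∈ Ideal.span {x} ⊔ I → w ∈ Ideal.span {x} ⊔ I)
    (h2 : ∀ w, z * w ∈ Ideal.span {x ^ (k + 1)} ⊔ I → w ∈ Ideal.span {x ^ (k + 1)} ⊔ I)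
    (h3 : ∀ w, x * w ∈ I → w ∈ I) (w : R)
    (hw : z * w ∈ Ideal.span {x ^ (k + 1 + 1)} ⊔ I) : w ∈ Ideal.span {x ^ (k + 1 + 1)} ⊔ I := by
  have h3' : ∀ (m : ℕ) (w : R), x ^ m * w ∈ I → w ∈ I := by
    intro m
    induction m with
    | zero => intro w hw; simpa using hw
    | succ m ih => intro w hw; exact h3 _ (ih _ (by rwa [pow_succ, mul_assoc] at hw))
  obtain ⟨r, i, hi, hr⟩ := Ideal.mem_span_singleton_sup.1 hw
  have hw' : z * w ∈ Ideal.span {x ^ (k + 1)} ⊔ I :=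
    Ideal.mem_span_singleton_sup.2 ⟨r * x, i, hi, by rw [← hr]; ring⟩
  obtain ⟨w', i', hi', hr'⟩ := Ideal.mem_span_singleton_sup.1 (h2 w hw')
  have h4 : z * w' - x * r ∈ I := by
    apply h3' (k + 1)
    have : x ^ (k + 1) * (z * w' - x * r) = i - z * i' := by
      have e1 : r * x ^ (k + 1 + 1) + i = z * (w' * x ^ (k + 1) + i') := by rw [hr, hr']
      linear_combination -e1
    rw [this]
    exact I.sub_mem hi (I.mul_mem_left _ hi')
  have h5 := h1 w' (Ideal.mem_span_singleton_sup.2 ⟨r, _, h4, by ring⟩)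
  obtain ⟨s, i'', hi'', hs⟩ := Ideal.mem_span_singleton_sup.1 h5
  refine Ideal.mem_span_singleton_sup.2 ⟨s, x ^ (k + 1) * i'' + i', 
    I.add_mem (I.mul_mem_left _ hi'') hi', ?_⟩
  rw [← hr', ← hs]; ring

variable [Fintype ι] [IsLocalRing R] [IsNoetherianRing R]

theorem span_prime (x : ι → R) (hx : Ideal.span (Set.range x) = maximalIdeal R)
    (hd : ringKrullDim R = (Fintype.card ι : ℕ)) (T : Finset ι) :
    (Ideal.span (x '' (T : Set ι))).IsPrime := by
  classical
  have h1 : Ideal.span (((Tᶜ.image x : Finset R) : Set R) ∪ (T.image x : Finset R)) = maximalIdeal R := by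
    rw [← hx]
    congr 1
    rw [Finset.coe_image, Finset.coe_image, ← Set.image_union, Finset.coe_compl, Set.compl_union_self,
      Set.image_univ]
  have hc : (Tᶜ.image x).card + (T.image x).card ≤ Fintype.card ι := by
    have := Finset.card_image_le (s := Tᶜ) (f := x)
    have := Finset.card_image_le (s := T) (f := x)
    have := Finset.card_compl_add_card T
    omega
  obtain ⟨_, S', hS', hs', hd', -⟩ := quot_aux _ _ h1 hc hd
  have := isDomain_of_regular _ _ S' hS' hs' hd'
  rw [Ideal.Quotient.isDomain_iff_prime, Finset.coe_image] at this
  exact this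

theorem notMem_span (x : ι → R) (hx : Ideal.span (Set.range x) = maximalIdeal R)
    (hd : ringKrullDim R = (Fintype.card ι : ℕ)) (T : Finset ι) (i : ι) (hi : i ∉ T) :
    x i ∉ Ideal.span (x '' (T : Set ι)) := by
  classical
  intro h
  have h1 : Ideal.span ((((Finset.univ.erase i).image x : Finset R)) : Set R) = maximalIdeal R := by
    rw [← hx]
    apply le_antisymm
    · apply Ideal.span_mono
      rw [Finset.coe_image]
      exact Set.image_subset_range _ _
    · rw [Ideal.span_le]
      rintro _ ⟨j, rfl⟩
      by_cases hj : j = i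
      · subst hj
        refine Ideal.span_mono ?_ h
        rw [Finset.coe_image]
        apply Set.image_mono
        intro k hk
        have : k ≠ j := by rintro rfl; exact hi hk
        simpa using this
      · exact Ideal.subset_span (by simpa using ⟨j, hj, rfl⟩)
  have h2 := dim_le_card _ h1
  rw [hd] at h2
  have h3 : Fintype.card ι ≤ ((Finset.univ.erase i).image x).card := by exact_mod_cast h2
  have h4 := Finset.card_image_le (s := Finset.univ.erase i) (f := x)
  rw [Finset.card_erase_of_mem (Finset.mem_univ _), Finset.card_univ] at h4
  have : 0 < Fintype.card ι := Fintype.card_pos_iff.2 ⟨i⟩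
  omega

theorem nzd_powIdeal (x : ι → R) (hx : Ideal.span (Set.range x) = maximalIdeal R)
    (hd : ringKrullDim R = (Fintype.card ι : ℕ)) (N : ℕ) : ∀ (a : ι → ℕ) (T : Finset ι) (i : ι),
    i ∉ T → ∑ j ∈ T, a j ≤ N → ∀ w, x i * w ∈ powIdeal x a T → w ∈ powIdeal x a T := by
  induction N with
  | zero =>
    intro a T i hi hN w hw
    rw [powIdeal_zero x a T (by simpa using hN)] at hw ⊢
    exact ((span_prime x hx hd T).mem_or_mem hw).resolve_left (notMem_span x hx hd T i hi)
  | succ N ih =>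
    intro a T i hi hN w hw
    by_cases h0 : ∀ j ∈ T, a j = 0
    · rw [powIdeal_zero x a T h0] at hw ⊢
      exact ((span_prime x hx hd T).mem_or_mem hw).resolve_left (notMem_span x hx hd T i hi)
    push Not at h0
    obtain ⟨j, hj, hj0⟩ := h0
    obtain ⟨k, hk⟩ := Nat.exists_eq_succ_of_ne_zero hj0
    have hT : insert j (T.erase j) = T := Finset.insert_erase hj
    have hjT : j ∉ T.erase j := Finset.notMem_erase _ _
    have hsum := Finset.add_sum_erase T a hj
    have hins : ∀ m : ℕ, powIdeal x (Function.update a j m) T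
        = Ideal.span {x j ^ (m + 1)} ⊔ powIdeal x a (T.erase j) := by
      intro m
      conv_lhs => rw [← hT]
      rw [powIdeal_insert, Function.update_self]
      congr 1
      apply powIdeal_congr
      intro l hl
      rw [Function.update_of_ne (Finset.ne_of_mem_erase hl)]
    have hsm : ∀ m : ℕ, ∑ l ∈ T, Function.update a j m l = m + ∑ l ∈ T.erase j, a l := by
      intro m
      rw [← Finset.add_sum_erase T _ hj, Function.update_self]
      congr 1
      apply Finset.sum_congr rfl
      intro l hl
      rw [Function.update_of_ne (Finset.ne_of_mem_erase hl)]
    have ha : Function.update a j (k + 1) = a := by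
      rw [Function.update_eq_self_iff]; exact hk.symm
    have key := hins (k + 1)
    rw [ha] at key
    rw [key] at hw ⊢
    refine nzd_step _ (x i) (x j) k ?_ ?_ ?_ w hw
    · intro w hw
      have := ih (Function.update a j 0) T i hi (by rw [hsm]; omega) w
      rw [hins] at this
      simpa using this (by simpa using hw)
    · intro w hw
      have := ih (Function.update a j k) T i hi (by rw [hsm]; omega) w
      rw [hins] at this
      exact this hw
    · exact ih a (T.erase j) j hjT (by omega)

theorem prod_notMem (x : ι → R) (hx : Ideal.span (Set.range x) = maximalIdeal R)
    (hd : ringKrullDim R = (Fintype.card ι : ℕ)) (N : ℕ) : ∀ (a : ι → ℕ), ∑ j, a j ≤ N →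
    ∏ j, x j ^ a j ∉ powIdeal x a Finset.univ := by
  have base : ∀ (a : ι → ℕ), (∀ j, a j = 0) → ∏ j, x j ^ a j ∉ powIdeal x a Finset.univ := by
    intro a ha
    rw [powIdeal_zero x a _ (fun j _ => ha j)]
    simp only [ha, pow_zero, Finset.prod_const_one, Finset.coe_univ, Set.image_univ, hx]
    exact fun h => (maximalIdeal.isMaximal R).ne_top ((Ideal.eq_top_iff_one _).2 h)
  induction N with
  | zero => intro a ha; exact base a (by simpa using ha)
  | succ N ih =>
    intro a ha hmem
    by_cases h0 : ∀ j, a j = 0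
    · exact base a h0 hmem
    push Not at h0
    obtain ⟨j, hj0⟩ := h0
    obtain ⟨k, hk⟩ := Nat.exists_eq_succ_of_ne_zero hj0
    have hT : insert j (Finset.univ.erase j) = Finset.univ := Finset.insert_erase (Finset.mem_univ j)
    have hjT : j ∉ Finset.univ.erase j := Finset.notMem_erase _ _
    have hsum := Finset.add_sum_erase Finset.univ a (Finset.mem_univ j)
    have hins : powIdeal x (Function.update a j k) Finset.univ
        = Ideal.span {x j ^ (k + 1)} ⊔ powIdeal x a (Finset.univ.erase j) := by
      conv_lhs => rw [← hT]
      rw [powIdeal_insert, Function.update_self]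
      congr 1
      apply powIdeal_congr
      intro l hl
      rw [Function.update_of_ne (Finset.ne_of_mem_erase hl)]
    have hsm : ∑ l, Function.update a j k l = k + ∑ l ∈ Finset.univ.erase j, a l := by
      rw [← Finset.add_sum_erase Finset.univ _ (Finset.mem_univ j), Function.update_self]
      congr 1
      apply Finset.sum_congr rfl
      intro l hl
      rw [Function.update_of_ne (Finset.ne_of_mem_erase hl)]
    have hpr : ∏ l, x l ^ Function.update a j k l = x j ^ k * ∏ l ∈ Finset.univ.erase j, x l ^ a l := by
      rw [← Finset.mul_prod_erase Finset.univ _ (Finset.mem_univ j), Function.update_self]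
      congr 1
      apply Finset.prod_congr rfl
      intro l hl
      rw [Function.update_of_ne (Finset.ne_of_mem_erase hl)]
    apply ih (Function.update a j k) (by rw [hsm]; omega)
    rw [hins, hpr]
    rw [← hT, powIdeal_insert, hT, ← Finset.mul_prod_erase Finset.univ _ (Finset.mem_univ j), hk] at hmem
    obtain ⟨r, i, hi, hr⟩ := Ideal.mem_span_singleton_sup.1 hmem
    set w := x j ^ k * ∏ l ∈ Finset.univ.erase j, x l ^ a l with hw
    have h1 : x j * (w - r * x j ^ (k + 1)) ∈ powIdeal x a (Finset.univ.erase j) := by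
      have : x j * (w - r * x j ^ (k + 1)) = i := by
        rw [hw]
        simp only [Nat.succ_eq_add_one] at hr
        linear_combination -hr
      rw [this]; exact hi
    have h2 := nzd_powIdeal x hx hd _ a _ j hjT le_rfl _ h1
    exact Ideal.mem_span_singleton_sup.2 ⟨r, _, h2, by ring⟩

/-- Key combinatorial statement: exponents of a unit expansion lie above those of any expansion. -/
theorem exists_le_of_sum_eq (x : ι → R) (hx : Ideal.span (Set.range x) = maximalIdeal R)
    (hd : ringKrullDim R = (Fintype.card ι : ℕ)) (S S' : Finset (ι → ℕ)) (c c' : (ι → ℕ) → R)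
    (hc : ∀ a ∈ S, IsUnit (c a))
    (h : ∑ a ∈ S, c a * ∏ j, x j ^ a j = ∑ a ∈ S', c' a * ∏ j, x j ^ a j) :
    ∀ a ∈ S, ∃ b ∈ S', b ≤ a := by
  classical
  by_contra! hcon
  obtain ⟨a₀, ha₀, hb₀⟩ := hcon
  obtain ⟨a, ha⟩ := (S.filter (fun a => ∀ b ∈ S', ¬ b ≤ a)).exists_minimal
    ⟨a₀, Finset.mem_filter.2 ⟨ha₀, hb₀⟩⟩
  obtain ⟨haS, hab⟩ := Finset.mem_filter.1 ha.prop
  have hmem : ∀ b : ι → ℕ, ¬ b ≤ a → ∀ r : R, r * ∏ j, x j ^ b j ∈ powIdeal x a Finset.univ := by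
    intro b hb r
    rw [Pi.le_def, not_forall] at hb
    obtain ⟨j, hj⟩ := hb
    apply Ideal.mul_mem_left
    rw [← Finset.mul_prod_erase Finset.univ _ (Finset.mem_univ j)]
    apply Ideal.mul_mem_right
    exact Ideal.mem_of_dvd _ (pow_dvd_pow (x j) (by omega : a j + 1 ≤ b j))
      (Ideal.subset_span ⟨j, by simp, rfl⟩)
  have h1 : c a * ∏ j, x j ^ a j ∈ powIdeal x a Finset.univ := by
    rw [← Finset.add_sum_erase _ _ haS] at h
    rw [eq_sub_of_add_eq h]
    refine Ideal.sub_mem _ (Ideal.sum_mem _ fun b hb => hmem b (hab b hb) _)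
      (Ideal.sum_mem _ fun b hb => hmem b ?_ _)
    intro hle
    obtain ⟨hne, hbS⟩ := Finset.mem_erase.1 hb
    have : b ∈ S.filter (fun a => ∀ b ∈ S', ¬ b ≤ a) :=
      Finset.mem_filter.2 ⟨hbS, fun b' hb' h' => hab b' hb' (h'.trans hle)⟩
    exact hne (le_antisymm hle (ha.le_of_le this hle))
  rw [Ideal.unit_mul_mem_iff_mem _ (hc a haS)] at h1
  exact prod_notMem x hx hd _ a le_rfl h1
end

section polyhedra

/-- Evaluation of a rational linear form at a real vector. -/
def evq {ι : Type*} [Fintype ι] (a : ι → ℚ) (v : ι → ℝ) : ℝ := ∑ i, (a i : ℝ) * v i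

theorem evq_sub_smul {ι : Type*} [Fintype ι] (a : ι → ℚ) (v w : ι → ℝ) (t : ℝ) :
    evq a (v - t • w) = evq a v - t * evq a w := by
  simp only [evq, Finset.mul_sum, ← Finset.sum_sub_distrib]
  refine Finset.sum_congr rfl fun i _ => ?_
  simp only [Pi.sub_apply, Pi.smul_apply, smul_eq_mul]; ring

theorem evq_comb {ι : Type*} [Fintype ι] (a b : ι → ℚ) (s t : ℚ) (v : ι → ℝ) :
    evq (fun i => s * a i - t * b i) v = s * evq a v - t * evq b v := by
  simp only [evq, Finset.mul_sum, ← Finset.sum_sub_distrib]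
  refine Finset.sum_congr rfl fun i _ => ?_
  push_cast; ring

/-- One step of Fourier-Motzkin elimination. -/
theorem elim_step {ι : Type*} [Fintype ι] (A : Set (ι → ℚ)) (hA : A.Finite) (q : ι → ℚ) :
    ∃ A' : Set (ι → ℚ), A'.Finite ∧ ∀ v : ι → ℝ,
      (∃ t : ℝ, 0 ≤ t ∧ ∀ a ∈ A, 0 ≤ evq a (v - t • fun i => (q i : ℝ))) ↔
        ∀ a ∈ A', 0 ≤ evq a v := by
  classical
  let e : (ι → ℚ) → ℚ := fun a => ∑ i, a i * q i
  have he : ∀ a, evq a (fun i => (q i : ℝ)) = (e a : ℝ) := by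
    intro a; simp [evq, e]
  refine ⟨{a ∈ A | 0 ≤ e a} ∪
    (fun p : (ι → ℚ) × (ι → ℚ) => fun i => e p.1 * p.2 i - e p.2 * p.1 i) ''
      ({a ∈ A | 0 ≤ e a} ×ˢ {a ∈ A | e a < 0}), ?_, ?_⟩
  · exact (hA.sep _).union (((hA.sep _).prod (hA.sep _)).image _)
  intro v
  constructor
  · rintro ⟨t, ht, h⟩ a (⟨haA, ha⟩ | ⟨⟨b, c⟩, ⟨⟨hbA, hb⟩, ⟨hcA, hc⟩⟩, rfl⟩)
    · have := h a haA
      rw [evq_sub_smul, he] at this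
      have ha' : (0 : ℝ) ≤ e a := by exact_mod_cast ha
      nlinarith [mul_nonneg ht ha']
    · have h1 := h b hbA
      have h2 := h c hcA
      simp only at hb hc ⊢
      rw [evq_sub_smul, he] at h1 h2
      rw [evq_comb]
      have hb' : (0 : ℝ) ≤ e b := by exact_mod_cast hb
      have hc' : (e c : ℝ) < 0 := by exact_mod_cast hc
      nlinarith [mul_nonneg hb' h2, mul_nonneg (neg_nonneg.2 hc'.le) h1]
  · intro h
    have hB : {a ∈ A | e a < 0}.Finite := hA.sep _
    let F : Finset ℝ := insert 0 (hB.toFinset.image fun a => evq a v / (e a : ℝ))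
    obtain ⟨t, htF, ht⟩ := F.exists_max_image id ⟨0, Finset.mem_insert_self _ _⟩
    refine ⟨t, ht 0 (Finset.mem_insert_self _ _), ?_⟩
    intro a ha
    rw [evq_sub_smul, he]
    by_cases hea : e a < 0
    · have h1 : evq a v / (e a : ℝ) ≤ t := ht _ (Finset.mem_insert_of_mem
        (Finset.mem_image.2 ⟨a, by simpa using ⟨ha, hea⟩, rfl⟩))
      have hea' : (e a : ℝ) < 0 := by exact_mod_cast hea
      rw [div_le_iff_of_neg hea'] at h1
      linarith
    · push Not at hea
      have hav := h a (Or.inl ⟨ha, hea⟩)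
      rcases Finset.mem_insert.1 htF with rfl | htF
      · simpa using hav
      · obtain ⟨b, hb, rfl⟩ := Finset.mem_image.1 htF
        obtain ⟨hbA, hbe⟩ : b ∈ A ∧ e b < 0 := by simpa using hb
        have h1 := h _ (Or.inr ⟨(a, b), ⟨⟨ha, hea⟩, ⟨hbA, hbe⟩⟩, rfl⟩)
        rw [evq_comb] at h1
        simp only at h1
        have hb' : (e b : ℝ) < 0 := by exact_mod_cast hbe
        have : evq a v - evq b v / (e b : ℝ) * (e a : ℝ)
          = (e a * evq b v - e b * evq a v) / (-(e b : ℝ)) := by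
          have := hb'.ne
          field_simp
          ring
        rw [this]
        exact div_nonneg h1 (by linarith)

/-- Homogenization. -/
def hom {d : ℕ} {K : Type*} (x : Fin d → K) (s : K) : Option (Fin d) → K := fun o => o.elim s x

/-- The homogenized polyhedron generated by a list of rational points. -/
def hcone {d : ℕ} : List (Fin d → ℚ) → Set (Option (Fin d) → ℝ)
  | [] => {v | (∀ i, 0 ≤ v (some i)) ∧ v none = 0}
  | q :: l => {v | ∃ t : ℝ, 0 ≤ t ∧ v - t • (fun i => ((hom q 1 i : ℚ) : ℝ)) ∈ hcone l}

theorem hcone_finite {d : ℕ} (l : List (Fin d → ℚ)) :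
    ∃ A : Set (Option (Fin d) → ℚ), A.Finite ∧ hcone l = {v | ∀ a ∈ A, 0 ≤ evq a v} := by
  classical
  induction l with
  | nil =>
    refine ⟨Set.range (fun i => Pi.single i 1) ∪ {Pi.single none (-1)},
      (Set.finite_range _).union (Set.finite_singleton _), ?_⟩
    ext v
    have hs : ∀ (o : Option (Fin d)) (r : ℚ), evq (Pi.single o r) v = r * v o := by
      intro o r
      rw [evq, Finset.sum_eq_single o]
      · simp
      · intro b _ hb; simp [hb]
      · simp
    simp only [hcone, Set.mem_ofPred_eq]
    constructor
    · rintro ⟨h1, h2⟩ a (⟨o, rfl⟩ | rfl)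
      · simp only [hs]
        cases o with
        | none => simp [h2]
        | some i => simpa using h1 i
      · simp [hs, h2]
    · intro h
      have h1 : ∀ o, 0 ≤ v o := fun o => by
        have := h _ (Or.inl ⟨o, rfl⟩)
        simpa [hs] using this
      have h2 := h _ (Or.inr rfl)
      rw [hs] at h2
      push_cast at h2
      exact ⟨fun i => h1 _, by linarith [h1 none]⟩
  | cons q l ih =>
    obtain ⟨A, hA, h⟩ := ih
    obtain ⟨A', hA', h'⟩ := elim_step A hA (hom q 1)
    refine ⟨A', hA', ?_⟩
    ext v
    rw [Set.mem_ofPred_eq, ← h' v, hcone, h]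
    rfl

theorem hcone_add {d : ℕ} (l : List (Fin d → ℚ)) (w : Option (Fin d) → ℝ)
    (hw : ∀ i, 0 ≤ w (some i)) (hw0 : w none = 0) : ∀ v ∈ hcone l, v + w ∈ hcone l := by
  induction l with
  | nil =>
    rintro v ⟨h1, h2⟩
    exact ⟨fun i => add_nonneg (h1 i) (hw i), by simp [h2, hw0]⟩
  | cons q l ih =>
    rintro v ⟨t, ht, h⟩
    refine ⟨t, ht, ?_⟩
    have := ih _ h
    rwa [sub_add_eq_add_sub] at this

theorem hcone_zero {d : ℕ} (l : List (Fin d → ℚ)) : 0 ∈ hcone l := by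
  induction l with
  | nil => exact ⟨fun i => le_rfl, rfl⟩
  | cons q l ih => exact ⟨0, le_rfl, by simpa using ih⟩

theorem hcone_mem {d : ℕ} (l : List (Fin d → ℚ)) (p : Fin d → ℚ) (hp : p ∈ l) :
    hom (fun i => (p i : ℝ)) 1 ∈ hcone l := by
  induction l with
  | nil => simp at hp
  | cons q l ih =>
    rcases List.mem_cons.1 hp with rfl | hp
    · refine ⟨1, zero_le_one, ?_⟩
      convert hcone_zero l using 1
      ext o
      cases o <;> simp [hom]
    · exact ⟨0, le_rfl, by simpa using ih hp⟩

theorem hcone_sub {d : ℕ} (l : List (Fin d → ℚ)) (D : Set (Fin d → ℝ)) (hD : IsFSubset D)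
    (hl : ∀ p ∈ l, (fun i => (p i : ℝ)) ∈ D) :
    ∀ v ∈ hcone l, (∀ i, 0 ≤ v (some i)) ∧ 0 ≤ v none ∧
      (0 < v none → (fun i => (v none)⁻¹ * v (some i)) ∈ D) := by
  induction l with
  | nil =>
    rintro v ⟨h1, h2⟩
    exact ⟨h1, h2.ge, fun h => absurd h2 h.ne'⟩
  | cons q l ih =>
    rintro v ⟨t, ht, h⟩
    obtain ⟨h1, h2, h3⟩ := ih (fun p hp => hl p (List.mem_cons_of_mem _ hp)) _ h
    have hq : (fun i => (q i : ℝ)) ∈ D := hl q (List.mem_cons_self)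
    have hq0 : ∀ i, (0 : ℝ) ≤ q i := hD.1 hq
    simp only [hom, Pi.sub_apply, Pi.smul_apply, Option.elim, smul_eq_mul, Rat.cast_one, mul_one]
      at h1 h2 h3
    refine ⟨fun i => ?_, by linarith, fun hv => ?_⟩
    · have := h1 i
      nlinarith [mul_nonneg ht (hq0 i)]
    · rcases h2.eq_or_lt with h0 | h0
      · have hvt : v none = t := by linarith
        have := hD.2.2.2 _ hq (fun i => (v none)⁻¹ * (v (some i) - t * q i))
          (fun i => mul_nonneg (inv_nonneg.2 hv.le) (h1 i))
        convert this using 1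
        ext i
        simp only [Pi.add_apply]
        rw [← hvt]
        field_simp
        ring
      · have := hD.2.2.1 hq (h3 h0) (div_nonneg ht hv.le) (div_nonneg h2 hv.le)
          (by field_simp; ring)
        convert this using 1
        ext i
        simp only [Pi.add_apply, Pi.smul_apply, smul_eq_mul]
        have := h0.ne'
        field_simp
        ring

theorem evq_hom {d : ℕ} (a : Option (Fin d) → ℚ) (x : Fin d → ℝ) (s : ℝ) :
    evq a (hom x s) = a none * s + ∑ i, (a (some i) : ℝ) * x i := by
  simp [evq, hom, Fintype.sum_option]

theorem orthant_isF (d : ℕ) : IsFSubset (orthant d) := by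
  refine ⟨le_rfl, ?_, ?_, ?_⟩
  · have : orthant d = ⋂ i, {x | 0 ≤ x i} := by ext; simp [orthant]
    rw [this]
    exact isClosed_iInter fun i => isClosed_le continuous_const (continuous_apply i)
  · intro x hx y hy a b ha hb _ i
    exact add_nonneg (mul_nonneg ha (hx i)) (mul_nonneg hb (hy i))
  · intro v hv w hw i
    exact add_nonneg (hv i) (hw i)

theorem hcone_orthant {d : ℕ} (l : List (Fin d → ℚ)) (hl : ∀ p ∈ l, ∀ i, 0 ≤ p i)
    (x : Fin d → ℝ) (hx : hom x 1 ∈ hcone l) : x ∈ orthant d := by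
  intro i
  have := (hcone_sub l (orthant d) (orthant_isF d)
    (fun p hp i => Rat.cast_nonneg.2 (hl p hp i)) _ hx).1 i
  simpa [hom] using this

theorem smallest_eq {d : ℕ} (l : List (Fin d → ℚ)) (hl : ∀ p ∈ l, ∀ i, 0 ≤ p i) :
    smallestFSubset {x : Fin d → ℝ | ∃ p ∈ l, x = fun i => (p i : ℝ)} =
      {x | hom x 1 ∈ hcone l} := by
  apply Set.Subset.antisymm
  · apply Set.sInter_subset_of_mem
    refine ⟨⟨?_, ?_, ?_, ?_⟩, ?_⟩
    · exact fun x hx => hcone_orthant l hl x hx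
    · obtain ⟨A, hA, h⟩ := hcone_finite l
      rw [h]
      have : {x : Fin d → ℝ | hom x 1 ∈ {v | ∀ a ∈ A, 0 ≤ evq a v}} =
          ⋂ a ∈ A, {x | 0 ≤ (a none : ℝ) * 1 + ∑ i, (a (some i) : ℝ) * x i} := by
        ext x; simp [evq_hom]
      rw [this]
      refine isClosed_biInter fun a _ => isClosed_le continuous_const (by fun_prop)
    · obtain ⟨A, hA, h⟩ := hcone_finite l
      rw [h]
      intro x hx y hy s t hs ht hst a ha
      have h1 := hx a ha
      have h2 := hy a ha
      rw [evq_hom] at h1 h2 ⊢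
      have : (a none : ℝ) * 1 + ∑ i, (a (some i) : ℝ) * (s • x + t • y) i
        = s * (a none * 1 + ∑ i, (a (some i) : ℝ) * x i)
          + t * (a none * 1 + ∑ i, (a (some i) : ℝ) * y i) := by
        have e : ∑ i, (a (some i) : ℝ) * (s • x + t • y) i = s * (∑ i, (a (some i) : ℝ) * x i) +
            t * ∑ i, (a (some i) : ℝ) * y i := by
          rw [Finset.mul_sum, Finset.mul_sum, ← Finset.sum_add_distrib]
          refine Finset.sum_congr rfl fun i _ => ?_
          simp only [Pi.add_apply, Pi.smul_apply, smul_eq_mul]; ring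
        rw [e]
        linear_combination (-(a none : ℝ)) * hst
      rw [this]
      positivity
    · intro v hv w hw
      have := hcone_add l (hom w 0) (fun i => hw i) rfl _ hv
      rw [Set.mem_ofPred_eq]
      convert this using 1
      ext o
      cases o <;> simp [hom]
    · rintro _ ⟨p, hp, rfl⟩
      exact hcone_mem l p hp
  · apply Set.subset_sInter
    rintro D ⟨hD, hX⟩ x hx
    have := (hcone_sub l D hD (fun p hp => hX ⟨p, hp, rfl⟩) _ hx).2.2 (by simp [hom])
    simpa [hom] using this

theorem rational_smallest {d : ℕ} (l : List (Fin d → ℚ)) (hl : ∀ p ∈ l, ∀ i, 0 ≤ p i) :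
    IsRationalPolyhedron
      (smallestFSubset {x : Fin d → ℝ | ∃ p ∈ l, x = fun i => (p i : ℝ)}) := by
  classical
  rcases l with - | ⟨q, l⟩
  · have : smallestFSubset {x : Fin d → ℝ | ∃ p ∈ ([] : List (Fin d → ℚ)), x = fun i => (p i : ℝ)}
        = ∅ := by
      rw [smallest_eq _ hl]
      ext x
      simp [hcone, hom]
    rw [this]
    refine ⟨1, fun _ _ => 0, fun _ _ => le_rfl, ?_⟩
    ext x
    simp only [Set.mem_empty_iff_false, Set.mem_ofPred_eq, false_iff, not_and]
    intro _ h
    have := h 0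
    norm_num at this
  have hqq : hom (fun i => (q i : ℝ)) 1 ∈ hcone (q :: l) := hcone_mem _ q (List.mem_cons_self)
  have hor : ∀ x : Fin d → ℝ, hom x 1 ∈ hcone (q :: l) → x ∈ orthant d :=
    hcone_orthant _ hl
  rw [smallest_eq _ hl]
  obtain ⟨A, hA, h⟩ := hcone_finite (q :: l)
  have hnn : ∀ a ∈ A, ∀ i, 0 ≤ a (some i) := by
    intro a ha i
    by_contra! hneg
    have hneg' : (a (some i) : ℝ) < 0 := by exact_mod_cast hneg
    set C := evq a (hom (fun i => (q i : ℝ)) 1) with hC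
    have hC0 : 0 ≤ C := by rw [h] at hqq; exact hqq a ha
    let t : ℝ := (C + 1) / (-(a (some i) : ℝ))
    have ht : 0 ≤ t := div_nonneg (by linarith) (by linarith)
    have h1 := hcone_add (q :: l) (hom (Pi.single i t) 0) (fun j => by
      by_cases hj : j = i
      · subst hj; simpa [hom] using ht
      · simp [hom, hj]) rfl _ hqq
    rw [h] at h1
    have h2 := h1 a ha
    have h3 : evq a (hom (fun i => (q i : ℝ)) 1 + hom (Pi.single i t) 0)
        = C + (a (some i) : ℝ) * t := by
      rw [hC]
      have : evq a (hom (Pi.single i t) 0) = (a (some i) : ℝ) * t := by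
        rw [evq_hom]
        simp [Pi.single_apply]
      rw [← this]
      simp only [evq, Pi.add_apply, mul_add, Finset.sum_add_distrib]
    rw [h3] at h2
    have h4 : (a (some i) : ℝ) * t = -(C + 1) := by
      have := hneg'.ne
      simp only [t]
      field_simp
    linarith
  let B : Finset (Option (Fin d) → ℚ) := hA.toFinset.filter fun a => a none < 0
  let g := B.equivFin.symm
  refine ⟨B.card, fun j i => (-(g j).1 none)⁻¹ * (g j).1 (some i), ?_, ?_⟩
  · intro j i
    have hm := Finset.mem_filter.1 (g j).2
    have h2 := hm.2
    exact mul_nonneg (inv_nonneg.2 (by linarith)) (hnn _ (by simpa using hm.1) i)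
  · ext x
    have key : ∀ a ∈ B, (1 ≤ ∑ i, (((-a none)⁻¹ * a (some i) : ℚ) : ℝ) * x i ↔
        0 ≤ evq a (hom x 1)) := by
      intro a ha
      have h2 := (Finset.mem_filter.1 ha).2
      have h2' : (0 : ℝ) < -(a none : ℝ) := by
        have : (a none : ℝ) < 0 := by exact_mod_cast h2
        linarith
      have e : ∑ i, (((-a none)⁻¹ * a (some i) : ℚ) : ℝ) * x i
          = (-(a none : ℝ))⁻¹ * ∑ i, (a (some i) : ℝ) * x i := by
        rw [Finset.mul_sum]
        refine Finset.sum_congr rfl fun i _ => ?_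
        push_cast; ring
      rw [e, evq_hom, le_inv_mul_iff₀ h2']
      constructor <;> intro h <;> linarith
    constructor
    · intro hx
      refine ⟨hor x hx, fun j => ?_⟩
      rw [key _ (g j).2]
      rw [Set.mem_ofPred_eq, h] at hx
      exact hx _ (by simpa using (Finset.mem_filter.1 (g j).2).1)
    · rintro ⟨hx0, hx⟩
      rw [Set.mem_ofPred_eq, h]
      intro a ha
      by_cases hneg : a none < 0
      · have hB : a ∈ B := Finset.mem_filter.2 ⟨by simpa using ha, hneg⟩
        have := hx (g.symm ⟨a, hB⟩)
        simp only [Equiv.apply_symm_apply] at this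
        exact (key a hB).1 this
      · push Not at hneg
        rw [evq_hom]
        have h1 : (0 : ℝ) ≤ a none := by exact_mod_cast hneg
        have h2 : 0 ≤ ∑ i, (a (some i) : ℝ) * x i := Finset.sum_nonneg fun i _ =>
          mul_nonneg (by exact_mod_cast hnn a ha i) (hx0 i)
        linarith

end polyhedra

theorem monomial_eq {R : Type*} [CommRing R] {d : ℕ} (y : R) (u : Fin d → R)
    (ab : (Fin d → ℕ) × ℕ) :
    monomial y u ab = ∏ j, (Fin.cons y u : Fin (d + 1) → R) j ^
      (Fin.cons ab.2 ab.1 : Fin (d + 1) → ℕ) j := by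
  simp [monomial, Fin.prod_univ_succ]

theorem support_le {d : ℕ} {R : Type u} [CommRing R] [IsLocalRing R] [IsNoetherianRing R]
    (y : R) (u : Fin d → R) (hrsp : IsRSP R y u) (f : R)
    (c c' : ((Fin d → ℕ) × ℕ) →₀ R) (hc : IsUnitExpansion f y u c)
    (hc' : IsUnitExpansion f y u c') :
    ∀ ab ∈ c'.support, ∃ ab' ∈ c.support, ab'.1 ≤ ab.1 ∧ ab'.2 ≤ ab.2 := by
  classical
  let φ : (Fin d → ℕ) × ℕ → (Fin (d + 1) → ℕ) := fun ab => Fin.cons ab.2 ab.1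
  let ψ : (Fin (d + 1) → ℕ) → (Fin d → ℕ) × ℕ := fun g => (Fin.tail g, g 0)
  have hψ : ∀ ab, ψ (φ ab) = ab := fun ab => by simp [φ, ψ]
  have hφ : Function.Injective φ := Function.LeftInverse.injective hψ
  have hsum : ∀ c : ((Fin d → ℕ) × ℕ) →₀ R, IsUnitExpansion f y u c →
      ∑ g ∈ c.support.image φ, c (ψ g) * ∏ j, (Fin.cons y u : Fin (d + 1) → R) j ^ g j = f := by
    intro c hc
    rw [Finset.sum_image (fun a _ b _ h => hφ h), hc.2, Finsupp.sum]
    refine Finset.sum_congr rfl fun ab _ => ?_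
    rw [hψ, monomial_eq]
  intro ab hab
  obtain ⟨g, hg, hle⟩ := exists_le_of_sum_eq (Fin.cons y u : Fin (d + 1) → R) hrsp.1
    (by rw [hrsp.2, Fintype.card_fin]) (c'.support.image φ) (c.support.image φ)
    (fun g => c' (ψ g)) (fun g => c (ψ g))
    (by
      intro g hg
      obtain ⟨ab, hab, rfl⟩ := Finset.mem_image.1 hg
      simp only [hψ]
      exact hc'.1 ab hab)
    ((hsum c' hc').trans (hsum c hc).symm) (φ ab) (Finset.mem_image_of_mem _ hab)
  obtain ⟨ab', hab', rfl⟩ := Finset.mem_image.1 hg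
  refine ⟨ab', hab', fun i => ?_, ?_⟩
  · simpa [φ] using hle i.succ
  · simpa [φ] using hle 0

theorem expPoints_sub {d : ℕ} (m : ℕ) (s s' : Finset ((Fin d → ℕ) × ℕ))
    (h : ∀ ab ∈ s', ∃ ab' ∈ s, ab'.1 ≤ ab.1 ∧ ab'.2 ≤ ab.2) (D : Set (Fin d → ℝ))
    (hD : IsFSubset D) (hs : expPoints m s ⊆ D) : expPoints m s' ⊆ D := by
  rintro _ ⟨ab, hab, hm, rfl⟩
  obtain ⟨ab', hab', h1, h2⟩ := h ab hab
  have hp : projPoint m ab' ∈ D := hs ⟨ab', hab', by omega, rfl⟩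
  have := hD.2.2.2 _ hp (projPoint m ab - projPoint m ab') (fun i => by
    simp only [Pi.sub_apply, projPoint, sub_nonneg]
    have hm' : (ab.2 : ℝ) < m := by exact_mod_cast hm
    have h2' : (ab'.2 : ℝ) ≤ ab.2 := by exact_mod_cast h2
    have h1' : (ab'.1 i : ℝ) ≤ ab.1 i := by exact_mod_cast h1 i
    exact div_le_div₀ (Nat.cast_nonneg _) h1' (by linarith) (by linarith))
  simpa using this

theorem rational_expPoints {d : ℕ} (m : ℕ) (s : Finset ((Fin d → ℕ) × ℕ)) :
    IsRationalPolyhedron (smallestFSubset (expPoints m s)) := by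
  classical
  let l : List (Fin d → ℚ) := (s.filter (fun ab => ab.2 < m)).toList.map
    (fun ab i => (ab.1 i : ℚ) / ((m : ℚ) - ab.2))
  have h : expPoints m s = {x : Fin d → ℝ | ∃ p ∈ l, x = fun i => (p i : ℝ)} := by
    ext x
    constructor
    · rintro ⟨ab, hab, hm, rfl⟩
      refine ⟨_, List.mem_map.2 ⟨ab, by simp [hab, hm], rfl⟩, ?_⟩
      ext i
      simp [projPoint]
    · rintro ⟨p, hp, rfl⟩
      obtain ⟨ab, hab, rfl⟩ := List.mem_map.1 hp
      obtain ⟨h1, h2⟩ : ab ∈ s ∧ ab.2 < m := by simpa using hab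
      refine ⟨ab, h1, h2, ?_⟩
      ext i
      simp [projPoint]
  rw [h]
  apply rational_smallest
  intro p hp i
  obtain ⟨ab, hab, rfl⟩ := List.mem_map.1 hp
  obtain ⟨h1, h2⟩ : ab ∈ s ∧ ab.2 < m := by simpa using hab
  have : (ab.2 : ℚ) < m := by exact_mod_cast h2
  exact div_nonneg (Nat.cast_nonneg _) (by linarith)

/-- `Δ(f; u; y)` does not depend on the chosen finite unit-coefficient expansion of
`f`, and it is a rational polyhedron. -/
theorem delta_independent_of_expansion_and_rational
    {d : ℕ} (R : Type u) [CommRing R] [IsLocalRing R]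
    (hreg : IsRegularLocalRing R) (y : R) (u : Fin d → R) (hrsp : IsRSP R y u)
    (f : R) (hfM : f ∈ maximalIdeal R) (hfu : f ∉ Ideal.span (Set.range u)) :
    (∀ c : ((Fin d → ℕ) × ℕ) →₀ R, IsUnitExpansion f y u c →
      smallestFSubset (expPoints (ordRes f u) c.support) = Delta f y u) ∧
    IsRationalPolyhedron (Delta f y u) := by
  have := hreg.1
  have ind : ∀ c : ((Fin d → ℕ) × ℕ) →₀ R, IsUnitExpansion f y u c →
      smallestFSubset (expPoints (ordRes f u) c.support) = Delta f y u := by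
    intro c hc
    apply Set.Subset.antisymm
    · apply Set.subset_sInter
      rintro D ⟨hD, hX⟩
      refine Set.sInter_subset_of_mem ⟨hD, fun x hx => hX ?_⟩
      exact Set.mem_biUnion (show c ∈ {c | IsUnitExpansion f y u c} from hc) hx
    · apply Set.subset_sInter
      rintro D ⟨hD, hX⟩
      refine Set.sInter_subset_of_mem ⟨hD, Set.iUnion₂_subset fun c' hc' => ?_⟩
      exact expPoints_sub _ _ _ (support_le y u hrsp f c c' hc hc') D hD hX
  refine ⟨ind, ?_⟩
  by_cases hex : ∃ c : ((Fin d → ℕ) × ℕ) →₀ R, IsUnitExpansion f y u c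
  · obtain ⟨c, hc⟩ := hex
    rw [← ind c hc]
    exact rational_expPoints _ _
  · have h0 : Delta f y u = smallestFSubset (expPoints (ordRes f u) ∅) := by
      rw [Delta, DeltaOf]
      congr 1
      ext x
      simp only [Set.mem_iUnion, expPoints]
      constructor
      · rintro ⟨c, hc, _⟩
        exact absurd ⟨c, hc⟩ hex
      · rintro ⟨ab, hab, _⟩
        simp at hab
    rw [h0]
    exact rational_expPoints _ _

end CharPolyhedra
end
end

section
/- Let (R,M,k) be a regular local ring which is a G-ring, with regular system of parameters (y,u_1,...,u_d), and let f ∈ M with f ∉ (u_1,...,u_d). Suppose that in the M-adic completion R̂ one has f = δ̂·ŷ^m with δ̂ ∈ R̂ a unit and (ŷ,u_1,...,u_d) a regular system of parameters of R̂. Then there exists z ∈ R such that (z) = √(f) is a prime ideal of R, (z)R̂ = (ŷ)R̂, (f) = (z)^m, and (z,u_1,...,u_d) is a regular system of parameters of R. -/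
/-!
Characteristic polyhedra of singularities without completion
(V. Cossart, O. Piltant), formalized statements.
-/

noncomputable section

open IsLocalRing TensorProduct

namespace CharPolyhedra

universe u v

/-! ### Monomial expansions and polyhedra -/

variable {R : Type u} [CommRing R]

/-- auxiliary: `M` generated by at most `n` elements and `n ≤ dim`. -/
def PReg (n : ℕ) (R : Type u) [CommRing R] [IsLocalRing R] : Prop :=
  ∃ S : Finset R, S.card ≤ n ∧ Ideal.span (S : Set R) = maximalIdeal R ∧
    (n : WithBot ℕ∞) ≤ ringKrullDim R

lemma isLocal_quot {R : Type u} [CommRing R] [IsLocalRing R] (x : R) (hx : x ∈ maximalIdeal R) :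
    IsLocalRing (R ⧸ Ideal.span {x}) := by
  have hne : Ideal.span {x} ≠ ⊤ := by
    rw [Ne, Ideal.span_singleton_eq_top]
    exact hx
  have : Nontrivial (R ⧸ Ideal.span {x}) := Ideal.Quotient.nontrivial_iff.mpr hne
  exact IsLocalRing.of_surjective' (Ideal.Quotient.mk _) Ideal.Quotient.mk_surjective

lemma preg_quot {R : Type u} [CommRing R] [IsLocalRing R] [IsNoetherianRing R] (n : ℕ) (x : R)
    (T : Finset R) (hT : T.card ≤ n)
    (hspan : Ideal.span (insert x (T : Set R)) = maximalIdeal R)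
    (hdim : ((n + 1 : ℕ) : WithBot ℕ∞) ≤ ringKrullDim R)
    [IsLocalRing (R ⧸ Ideal.span {x})] :
    PReg n (R ⧸ Ideal.span {x}) := by
  classical
  have hx : x ∈ maximalIdeal R := hspan ▸ Ideal.subset_span (Set.mem_insert _ _)
  refine ⟨T.image (Ideal.Quotient.mk _), Finset.card_image_le.trans hT, ?_, ?_⟩
  · have h1 : (maximalIdeal R).map (Ideal.Quotient.mk (Ideal.span {x}))
        = maximalIdeal (R ⧸ Ideal.span {x}) := by
      apply IsLocalRing.eq_maximalIdeal
      apply Ideal.IsMaximal.map_of_surjective_of_ker_le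
        Ideal.Quotient.mk_surjective
      rw [Ideal.mk_ker, Ideal.span_singleton_le_iff_mem]
      exact hx
    rw [← h1, ← hspan, Ideal.map_span, Set.image_insert_eq, Finset.coe_image]
    have : Ideal.Quotient.mk (Ideal.span {x}) x = 0 := by
      rw [Ideal.Quotient.eq_zero_iff_mem]; exact Ideal.mem_span_singleton_self x
    rw [this, Ideal.span_insert_zero]
  · have := Ideal.height_le_ringKrullDim_quotient_add_one hx
    rw [IsLocalRing.maximalIdeal_height_eq_ringKrullDim] at this
    have h2 := hdim.trans this
    rw [Nat.cast_add, Nat.cast_one] at h2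
    exact ENat.WithBot.add_le_add_natCast_right_iff.mp h2

theorem isDomain_of_preg (n : ℕ) : ∀ (R : Type u) [CommRing R] [IsLocalRing R]
    [IsNoetherianRing R], PReg n R → IsDomain R := by
  classical
  induction n with
  | zero =>
    rintro R _ _ _ ⟨S, hS, hspan, -⟩
    have : S = ∅ := by simpa using hS
    subst this
    simp only [Finset.coe_empty, Ideal.span_empty] at hspan
    have : IsField R := IsLocalRing.isField_iff_maximalIdeal_eq.mpr hspan.symm
    exact this.isDomain
  | succ n ih =>
    rintro R _ _ _ ⟨S, hS, hspan, hdim⟩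
    have hMmin : ∀ p ∈ minimalPrimes R, ¬ maximalIdeal R ≤ p := by
      intro p hp hle
      have hpp : p.IsPrime := hp.1.1
      have : p = maximalIdeal R := le_antisymm (IsLocalRing.le_maximalIdeal hpp.ne_top) hle
      subst this
      have h0 := Ideal.height_eq_zero_iff.mpr hp
      have h1 := IsLocalRing.maximalIdeal_height_eq_ringKrullDim (R := R)
      rw [h0] at h1
      rw [← h1] at hdim
      have : ((n + 1 : ℕ) : ℕ∞) ≤ 0 := by exact_mod_cast hdim
      simp at this
    have hM2 : ¬ maximalIdeal R ≤ maximalIdeal R ^ 2 := by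
      intro hle
      have : maximalIdeal R = ⊥ := by
        apply Submodule.eq_bot_of_le_smul_of_le_jacobson_bot (maximalIdeal R) _
          (IsNoetherian.noetherian _)
        · rw [smul_eq_mul, ← pow_two]; exact hle
        · exact IsLocalRing.maximalIdeal_le_jacobson _
      obtain ⟨p, hp, -⟩ := Ideal.exists_minimalPrimes_le (I := (⊥ : Ideal R))
        (J := maximalIdeal R) bot_le
      exact hMmin p hp (this ▸ bot_le)
    have hfin : (minimalPrimes R).Finite := minimalPrimes.finite_of_isNoetherianRing R
    obtain ⟨x, hxM, hxs⟩ : ∃ x ∈ maximalIdeal R, x ∉ maximalIdeal R ^ 2 ∧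
        ∀ p ∈ minimalPrimes R, x ∉ p := by
      by_contra hcon
      push Not at hcon
      have := (Ideal.subset_union_prime (s := insert (maximalIdeal R ^ 2) hfin.toFinset)
        (f := fun I : Ideal R => I) (maximalIdeal R ^ 2) (maximalIdeal R ^ 2)
        (by
          intro i hi h1 _
          simp only [Finset.mem_insert, h1, Set.Finite.mem_toFinset, false_or] at hi
          exact hi.1.1) (I := maximalIdeal R)).mp (by
            intro x hx
            by_cases h2 : x ∈ maximalIdeal R ^ 2
            · exact Set.mem_biUnion (by simp) h2
            · obtain ⟨p, hp, hxp⟩ := hcon x hx h2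
              exact Set.mem_biUnion (by simp [hp]) hxp)
      obtain ⟨i, hi, hle⟩ := this
      simp only [Finset.mem_insert, Set.Finite.mem_toFinset] at hi
      rcases hi with rfl | hi
      · exact hM2 hle
      · exact hMmin i hi hle
    obtain ⟨hx2, hxp⟩ := hxs
    have hx' := hxM
    rw [← hspan, Submodule.mem_span_finset] at hx'
    obtain ⟨a, -, ha⟩ := hx'
    obtain ⟨t, htS, htu⟩ : ∃ t ∈ S, IsUnit (a t) := by
      by_contra hcon
      push Not at hcon
      apply hx2
      rw [← ha, pow_two]
      apply Ideal.sum_mem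
      intro t ht
      exact Ideal.mul_mem_mul (hcon t ht) (hspan ▸ Ideal.subset_span ht)
    have hspan' : Ideal.span (insert x ((S.erase t : Finset R) : Set R)) = maximalIdeal R := by
      apply le_antisymm
      · rw [Ideal.span_le]
        rintro s (rfl | hs)
        · exact hxM
        · exact hspan ▸ Ideal.subset_span (Finset.mem_of_mem_erase hs)
      · rw [← hspan, Ideal.span_le]
        intro s hs
        by_cases hst : s = t
        · subst hst
          have h1 : a s * s = x - ∑ i ∈ S.erase s, a i * i := by
            rw [← ha, ← Finset.add_sum_erase S _ htS]; simp
          have h2 : a s * s ∈ Ideal.span (insert x ((S.erase s : Finset R) : Set R)) := by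
            rw [h1]
            apply Ideal.sub_mem
            · exact Ideal.subset_span (Set.mem_insert _ _)
            · apply Ideal.sum_mem
              intro i hi
              exact Ideal.mul_mem_left _ _ (Ideal.subset_span (Set.mem_insert_of_mem _ hi))
          exact (Ideal.unit_mul_mem_iff_mem _ htu).mp h2
        · exact Ideal.subset_span (Set.mem_insert_of_mem _ (by simpa [hst] using hs))
    have hloc := isLocal_quot x hxM
    have hcard : (S.erase t).card ≤ n := by
      rw [Finset.card_erase_of_mem htS]; omega
    have hdom : IsDomain (R ⧸ Ideal.span {x}) :=
      ih _ (preg_quot n x _ hcard hspan' hdim)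
    have hprime : (Ideal.span {x}).IsPrime := (Ideal.Quotient.isDomain_iff_prime _).mp hdom
    obtain ⟨p, hp, hple⟩ := Ideal.exists_minimalPrimes_le (I := (⊥ : Ideal R))
        (J := Ideal.span {x}) bot_le
    have hpp : p.IsPrime := hp.1.1
    have hbot : p = ⊥ := by
      apply Submodule.eq_bot_of_le_smul_of_le_jacobson_bot (Ideal.span {x}) _
          (IsNoetherian.noetherian _)
      · intro b hb
        obtain ⟨c, rfl⟩ := Ideal.mem_span_singleton.mp (hple hb)
        rw [smul_eq_mul]
        exact Ideal.mul_mem_mul (Ideal.mem_span_singleton_self x)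
          ((hpp.mem_or_mem hb).resolve_left (hxp p hp))
      · exact (IsLocalRing.le_maximalIdeal hprime.ne_top).trans
          (IsLocalRing.maximalIdeal_le_jacobson _)
    subst hbot
    exact IsDomain.of_bot_isPrime R

theorem isDomain_of_regular_s12 (R : Type u) [CommRing R] [IsLocalRing R]
    (h : IsRegularLocalRing R) : IsDomain R := by
  classical
  obtain ⟨hN, n, s, hs, hd⟩ := h
  refine isDomain_of_preg n R ⟨Finset.univ.image s, ?_, ?_, hd.ge⟩
  · exact Finset.card_image_le.trans (by simp)
  · simpa using hs

theorem isReduced_of_regularRing (A : Type u) [CommRing A] (h : IsRegularRing A) :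
    IsReduced A := by
  refine ⟨fun a ha => ?_⟩
  by_contra hne
  have hann : Ideal.span {a} ≠ ⊥ := by simpa using hne
  have hI : Submodule.annihilator (Ideal.span {a}) ≠ ⊤ := by
    rw [Ne, Submodule.annihilator_eq_top_iff]; exact hann
  obtain ⟨P, hP, hle⟩ := Ideal.exists_le_maximal _ hI
  have hPp := hP.isPrime
  have := isDomain_of_regular_s12 _ (h.2 P)
  have h0 : algebraMap A (Localization.AtPrime P) a = 0 := by
    have : IsNilpotent (algebraMap A (Localization.AtPrime P) a) := ha.map _
    exact this.eq_zero
  rw [IsLocalization.map_eq_zero_iff P.primeCompl] at h0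
  obtain ⟨c, hc⟩ := h0
  apply c.2
  apply hle
  rw [Submodule.mem_annihilator_span_singleton]
  exact hc

lemma fiber_radical (S : Type u) [CommRing S] [IsLocalRing S] [IsNoetherianRing S]
    (h : HasGeomRegularFormalFibers S) (Q : Ideal S) [Q.IsPrime] (x : Completion S) (m : ℕ)
    (hx : x ^ m ∈ Q.map (cmpl (R := S))) : x ∈ Q.map (cmpl (R := S)) := by
  let κ := ResidueField (Localization.AtPrime Q)
  have hreg : IsRegularRing (κ ⊗[κ] (κ ⊗[S] Completion S)) := h Q κ
  have hred := isReduced_of_regularRing _ hreg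
  have hred2 : IsReduced (κ ⊗[S] Completion S) :=
    isReduced_of_injective
      (Algebra.TensorProduct.lid κ (κ ⊗[S] Completion S)).symm
      (Algebra.TensorProduct.lid κ (κ ⊗[S] Completion S)).symm.injective
  let φ : Completion S →ₐ[S] κ ⊗[S] Completion S := Algebra.TensorProduct.includeRight
  have halg : ∀ q, algebraMap S κ q = 0 ↔ q ∈ Q := by
    intro q
    rw [IsScalarTower.algebraMap_apply S (Localization.AtPrime Q) κ]
    change IsLocalRing.residue _ _ = 0 ↔ _
    rw [IsLocalRing.residue_eq_zero_iff]
    exact IsLocalization.AtPrime.to_map_mem_maximal_iff (Localization.AtPrime Q) Q q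
  have hker : Q.map (cmpl (R := S)) ≤ RingHom.ker φ := by
    rw [Ideal.map_le_iff_le_comap]
    intro q hq
    rw [Ideal.mem_comap, RingHom.mem_ker]
    have h1 : φ (cmpl q) = algebraMap S _ q := φ.commutes q
    rw [h1, IsScalarTower.algebraMap_apply S κ (κ ⊗[S] Completion S)]
    rw [(halg q).mpr hq, map_zero]
  have h0 : φ x = 0 := by
    have : φ x ^ m = 0 := by rw [← map_pow]; exact hker hx
    exact IsNilpotent.eq_zero ⟨m, this⟩
  have hkerS : Q ≤ LinearMap.ker (Algebra.linearMap S κ) := by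
    intro q hq
    rw [LinearMap.mem_ker]
    exact halg q |>.mpr hq
  let ι : (S ⧸ Q) →ₗ[S] κ := Submodule.liftQ Q (Algebra.linearMap S κ) hkerS
  have hι : Function.Injective ι := by
    rw [← LinearMap.ker_eq_bot]
    apply Submodule.ker_liftQ_eq_bot
    intro q hq
    exact (halg q).mp hq
  have hinj := Module.Flat.rTensor_preserves_injective_linearMap (M := Completion S) ι hι
  have h3 : (1 : S ⧸ Q) ⊗ₜ[S] x = 0 := by
    apply hinj
    rw [map_zero, LinearMap.rTensor_tmul]
    have : ι 1 = 1 := map_one (algebraMap S κ)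
    rw [this]
    exact h0
  have h4 := congrArg (TensorProduct.quotTensorEquivQuotSMul (Completion S) Q) h3
  rw [map_zero] at h4
  have h5 : TensorProduct.quotTensorEquivQuotSMul (Completion S) Q ((1 : S ⧸ Q) ⊗ₜ[S] x)
      = Submodule.Quotient.mk x := by
    have := TensorProduct.quotTensorEquivQuotSMul_mk_tmul Q (1 : S) x
    rw [one_smul] at this
    exact this
  rw [h5, Submodule.Quotient.mk_eq_zero, Ideal.smul_top_eq_map] at h4
  exact h4

/-- functoriality of the completion along a ring isomorphism. -/
lemma exists_completion_map (R S : Type u) [CommRing R] [IsLocalRing R] [CommRing S]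
    [IsLocalRing S] (e : R ≃+* S) (he : ∀ n, maximalIdeal R ^ n ≤
      (maximalIdeal S ^ n).comap (e : R →+* S)) :
    ∃ φ : Completion R →+* Completion S, ∀ n x,
      AdicCompletion.evalₐ (maximalIdeal S) n (φ x) =
        Ideal.quotientMap (maximalIdeal S ^ n) (e : R →+* S) (he n)
          (AdicCompletion.evalₐ (maximalIdeal R) n x) := by
  refine ⟨AdicCompletion.liftRingHom (maximalIdeal S) (fun n =>
    (Ideal.quotientMap (maximalIdeal S ^ n) (e : R →+* S) (he n)).comp
      (AdicCompletion.evalₐ (maximalIdeal R) n : _ →+* _)) ?_, ?_⟩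
  · intro m n hle
    ext x
    obtain ⟨x, rfl⟩ := AdicCompletion.mk_surjective _ _ x
    simp
    have hx := x.2 hle
    rw [SModEq.sub_mem, smul_eq_mul, Ideal.mul_top] at hx
    rw [eq_comm, Ideal.Quotient.eq, ← map_sub]
    exact he m hx
  · intro n x
    simp

lemma comap_pow_max (R S : Type u) [CommRing R] [IsLocalRing R] [CommRing S]
    [IsLocalRing S] (e : R ≃+* S) (n : ℕ) : maximalIdeal R ^ n ≤
      (maximalIdeal S ^ n).comap (e : R →+* S) := by
  rw [← Ideal.map_le_iff_le_comap, Ideal.map_pow]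
  apply Ideal.pow_right_mono
  rw [Ideal.map_le_iff_le_comap]
  intro x hx
  simpa using hx

lemma evalA_cmpl {R : Type u} [CommRing R] [IsLocalRing R] (n : ℕ) (r : R) :
    AdicCompletion.evalₐ (maximalIdeal R) n (cmpl r) = Ideal.Quotient.mk _ r :=
  AlgHom.commutes _ r

lemma fiber_radical' (R : Type u) [CommRing R] [IsLocalRing R] (hG : IsGRing R)
    (Q : Ideal R) [Q.IsPrime] (x : Completion R) (m : ℕ)
    (hx : x ^ m ∈ Q.map (cmpl (R := R))) : x ∈ Q.map (cmpl (R := R)) := by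
  have := hG.1
  let S := Localization.AtPrime (maximalIdeal R)
  let e : R ≃+* S := (IsLocalization.atUnits R (maximalIdeal R).primeCompl
    (fun x ↦ by simpa using! fun a ↦ a) : R ≃ₐ[R] S).toRingEquiv
  obtain ⟨φ, hφ⟩ := exists_completion_map R S e (comap_pow_max R S e)
  obtain ⟨ψ, hψ⟩ := exists_completion_map S R e.symm (comap_pow_max S R e.symm)
  have hφc : φ.comp cmpl = cmpl.comp (e : R →+* S) := by
    apply RingHom.ext
    intro r
    apply AdicCompletion.ext_evalₐ
    intro n
    simp only [RingHom.comp_apply]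
    rw [hφ, evalA_cmpl, evalA_cmpl, Ideal.quotientMap_mk]
  have hψc : ψ.comp cmpl = cmpl.comp (e.symm : S →+* R) := by
    apply RingHom.ext
    intro r
    apply AdicCompletion.ext_evalₐ
    intro n
    simp only [RingHom.comp_apply]
    rw [hψ, evalA_cmpl, evalA_cmpl, Ideal.quotientMap_mk]
  have hid : ∀ x, ψ (φ x) = x := by
    intro x
    apply AdicCompletion.ext_evalₐ
    intro n
    rw [hψ, hφ]
    obtain ⟨r, hr⟩ := Ideal.Quotient.mk_surjective (AdicCompletion.evalₐ (maximalIdeal R) n x)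
    rw [← hr, Ideal.quotientMap_mk, Ideal.quotientMap_mk]
    simp
  have hQ' : (Q.map (e : R →+* S)).IsPrime := Ideal.map_isPrime_of_equiv e
  have key := fiber_radical S (hG.2 (maximalIdeal R)) (Q.map (e : R →+* S)) (φ x) m (by
    rw [← map_pow, Ideal.map_map, ← hφc, ← Ideal.map_map]
    exact Ideal.mem_map_of_mem _ hx)
  have := Ideal.mem_map_of_mem ψ key
  rw [hid, Ideal.map_map, hψc, ← Ideal.map_map, Ideal.map_map (e : R →+* S)] at this
  simpa using this

lemma mem_of_forall_mem_sup {R : Type u} [CommRing R] [IsLocalRing R] [IsNoetherianRing R]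
    (I : Ideal R) (x : R) (h : ∀ n, x ∈ maximalIdeal R ^ n ⊔ I) : x ∈ I := by
  have hH : IsHausdorff (maximalIdeal R) (R ⧸ I) := inferInstance
  rw [← Ideal.Quotient.eq_zero_iff_mem]
  apply hH.haus
  intro n
  rw [SModEq.zero]
  obtain ⟨a, ha, b, hb, rfl⟩ := Submodule.mem_sup.mp (h n)
  rw [map_add, Ideal.Quotient.eq_zero_iff_mem.mpr hb, add_zero]
  have h1 : Ideal.Quotient.mk I a = a • (1 : R ⧸ I) := by
    rw [Algebra.smul_def, mul_one]; rfl
  rw [h1]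
  exact Submodule.smul_mem_smul ha trivial

lemma mem_span_of_cmpl {R : Type u} [CommRing R] [IsLocalRing R] [IsNoetherianRing R]
    (z g : R) (h : cmpl g ∈ Ideal.span {cmpl z}) : g ∈ Ideal.span {z} := by
  apply mem_of_forall_mem_sup
  intro n
  obtain ⟨c, hc⟩ := Ideal.mem_span_singleton.mp h
  have h1 := congrArg (AdicCompletion.evalₐ (maximalIdeal R) n) hc
  rw [map_mul, evalA_cmpl, evalA_cmpl] at h1
  obtain ⟨r, hr⟩ := Ideal.Quotient.mk_surjective (AdicCompletion.evalₐ (maximalIdeal R) n c)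
  rw [← hr, ← map_mul, Ideal.Quotient.eq] at h1
  rw [← sub_add_cancel g (z * r)]
  exact Submodule.add_mem_sup h1 (Ideal.mul_mem_right _ _ (Ideal.mem_span_singleton_self z))

lemma not_mem_of_ordRes {R : Type u} [CommRing R] [IsLocalRing R] [IsNoetherianRing R] {d : ℕ}
    (u : Fin d → R) (f : R) (hfu : f ∉ Ideal.span (Set.range u)) (n : ℕ)
    (hn : f ∈ maximalIdeal R ^ n) : n ≤ ordRes f u := by
  have hb : BddAbove {n : ℕ | f ∈ (maximalIdeal R) ^ n ⊔ Ideal.span (Set.range u)} := by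
    by_contra hcon
    rw [not_bddAbove_iff] at hcon
    apply hfu
    apply mem_of_forall_mem_sup
    intro k
    obtain ⟨N, hN, hk⟩ := hcon k
    have hle : maximalIdeal R ^ N ≤ maximalIdeal R ^ k := Ideal.pow_le_pow_right hk.le
    exact (sup_le_sup_right hle (Ideal.span (Set.range u))) hN
  exact le_csSup hb (Ideal.mem_sup_left hn)

lemma exists_uniformizer {d : ℕ} (R : Type u) [CommRing R] [IsLocalRing R] [IsNoetherianRing R]
    (u : Fin d → R) (hu : ∀ i, u i ∈ maximalIdeal R) (yh : Completion R) (hrsphat : IsRSPhat R yh u)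
    (Q : Ideal R) (hQ : Q ≤ maximalIdeal R) (hy : yh ∈ Q.map (cmpl (R := R))) :
    ∃ z ∈ Q, Ideal.span (insert z (Set.range u)) = maximalIdeal R := by
  let π : Completion R →+* R ⧸ maximalIdeal R ^ 2 :=
    (AdicCompletion.evalₐ (maximalIdeal R) 2 : _ →+* _)
  have hπ : π.comp cmpl = Ideal.Quotient.mk (maximalIdeal R ^ 2) :=
    RingHom.ext fun r => evalA_cmpl 2 r
  have h1 : π yh ∈ Q.map (Ideal.Quotient.mk (maximalIdeal R ^ 2)) := by
    rw [← hπ, ← Ideal.map_map]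
    exact Ideal.mem_map_of_mem _ hy
  obtain ⟨z, hz, hzy⟩ :=
    (Ideal.mem_map_iff_of_surjective _ Ideal.Quotient.mk_surjective).mp h1
  refine ⟨z, hz, ?_⟩
  have h2 := congrArg (Ideal.map π) hrsphat
  rw [Ideal.map_span, Set.image_insert_eq, ← Set.range_comp, Ideal.map_map, hπ, ← hzy] at h2
  have h3 : (π ∘ fun i => cmpl (u i)) = Ideal.Quotient.mk (maximalIdeal R ^ 2) ∘ u := by
    funext i
    exact congrArg (fun g : R →+* _ => g (u i)) hπ
  rw [h3, Set.range_comp, ← Set.image_insert_eq, ← Ideal.map_span] at h2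
  have hle : Ideal.span (insert z (Set.range u)) ≤ maximalIdeal R := by
    rw [Ideal.span_le]
    rintro _ (rfl | ⟨i, rfl⟩)
    · exact hQ hz
    · exact hu i
  apply le_antisymm hle
  apply Submodule.le_of_le_smul_of_le_jacobson_bot (I := maximalIdeal R)
    (IsNoetherian.noetherian _) (IsLocalRing.maximalIdeal_le_jacobson _)
  intro a ha
  have h4 := Ideal.mem_map_of_mem (Ideal.Quotient.mk (maximalIdeal R ^ 2)) ha
  rw [← h2] at h4
  obtain ⟨b, hb, hba⟩ :=
    (Ideal.mem_map_iff_of_surjective _ Ideal.Quotient.mk_surjective).mp h4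
  rw [eq_comm, Ideal.Quotient.eq] at hba
  rw [smul_eq_mul, ← pow_two, ← add_sub_cancel b a]
  exact Submodule.add_mem_sup hb hba

/-- (From the proof of **Lemma II.2**.) If in `R̂` one has `f = δ̂ ŷ^m` with `δ̂` a
unit and `(ŷ, u)` a r.s.p. of `R̂`, then there is `z ∈ R` with `(z) = √(f)` prime,
`(z)R̂ = (ŷ)`, `(f) = (z)^m` and `(z, u_1, ..., u_d)` a r.s.p. of `R`. -/
theorem rational_uniformizer_of_formal_power
    {d : ℕ} (R : Type u) [CommRing R] [IsLocalRing R]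
    (hreg : IsRegularLocalRing R) (hG : IsGRing R)
    (y : R) (u : Fin d → R) (hrsp : IsRSP R y u)
    (f : R) (hfM : f ∈ maximalIdeal R) (hfu : f ∉ Ideal.span (Set.range u))
    (m : ℕ) (hm : m = ordRes f u)
    (yh : Completion R) (hrsphat : IsRSPhat R yh u)
    (δ : Completion R) (hδ : IsUnit δ) (hfac : cmpl f = δ * yh ^ m) :
    ∃ z : R, (Ideal.span {z}).IsPrime ∧
      Ideal.span {z} = (Ideal.span {f}).radical ∧
      Ideal.span {cmpl z} = Ideal.span {yh} ∧
      Ideal.span {f} = Ideal.span {z} ^ m ∧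
      IsRSP R z u := by
  classical
  have hN : IsNoetherianRing R := hreg.1
  have hdomR : IsDomain R := isDomain_of_regular_s12 R hreg
  have hcons : ∀ w : R, Set.range (Fin.cons w u : Fin (d + 1) → R) = insert w (Set.range u) :=
    fun w => Fin.range_cons w u
  obtain ⟨hs, hdim⟩ := hrsp
  rw [hcons] at hs
  have hu : ∀ i, u i ∈ maximalIdeal R := fun i =>
    hs ▸ Ideal.subset_span (Set.mem_insert_of_mem _ ⟨i, rfl⟩)
  obtain ⟨Q, hQmin, hQM⟩ := Ideal.exists_minimalPrimes_le (I := Ideal.span {f})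
    (J := maximalIdeal R) (by rwa [Ideal.span_singleton_le_iff_mem])
  have hQp : Q.IsPrime := hQmin.1.1
  have hfQ : f ∈ Q := hQmin.1.2 (Ideal.mem_span_singleton_self f)
  have hyQ : yh ∈ Q.map (cmpl (R := R)) := by
    apply fiber_radical' R hG Q yh m
    have h1 : cmpl f ∈ Q.map (cmpl (R := R)) := Ideal.mem_map_of_mem _ hfQ
    rw [hfac] at h1
    exact (Ideal.unit_mul_mem_iff_mem _ hδ).mp h1
  obtain ⟨z, hzQ, hzs⟩ := exists_uniformizer R u hu yh hrsphat Q hQM hyQ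
  have hzM : z ∈ maximalIdeal R := hQM hzQ
  have hloc := isLocal_quot z hzM
  have hzs' : Ideal.span (insert z ((Finset.univ.image u : Finset R) : Set R))
      = maximalIdeal R := by
    rw [Finset.coe_image, Finset.coe_univ, Set.image_univ]; exact hzs
  have hzdom : IsDomain (R ⧸ Ideal.span {z}) :=
    isDomain_of_preg d _ (preg_quot d z (Finset.univ.image u)
      (Finset.card_image_le.trans (by simp)) hzs' hdim.ge)
  have hzP : (Ideal.span {z}).IsPrime := (Ideal.Quotient.isDomain_iff_prime _).mp hzdom
  have hz0 : z ≠ 0 := by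
    rintro rfl
    rw [Ideal.span_insert_zero] at hzs
    exact hfu (hzs ▸ hfM)
  have hf0 : f ≠ 0 := by
    rintro rfl
    exact hfu (Ideal.zero_mem _)
  have hzprime : Prime z := (Ideal.span_singleton_prime hz0).mp hzP
  have hQz : Q = Ideal.span {z} := by
    by_contra hne
    have hle : Ideal.span {z} ≤ Q := by rwa [Ideal.span_singleton_le_iff_mem]
    have hlt : Ideal.span {z} < Q := lt_of_le_of_ne hle (Ne.symm hne)
    have hb : (⊥ : Ideal R) < Ideal.span {z} := by
      rw [bot_lt_iff_ne_bot]; simpa using hz0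
    have h1 := Ideal.height_add_one_le_of_lt_of_isPrime hlt
    have h2 := Ideal.height_add_one_le_of_lt_of_isPrime hb
    have h3 := Ideal.height_le_one_of_isPrincipal_of_mem_minimalPrimes (Ideal.span {f}) Q hQmin
    have h4 : (1 : ℕ∞) + 1 ≤ 1 :=
      ((add_le_add_left (le_add_self.trans h2) 1).trans h1).trans h3
    exact absurd h4 (by decide)
  have hyz : yh ∈ Ideal.span {cmpl z} := by
    rwa [hQz, Ideal.map_span, Set.image_singleton] at hyQ
  obtain ⟨c, hc⟩ := Ideal.mem_span_singleton.mp hyz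
  have hzreg : IsSMulRegular (Completion R) (cmpl z) := by
    apply IsSMulRegular.of_flat
    exact fun a b hab => mul_left_cancel₀ hz0 hab
  obtain ⟨g, hfk, hzg⟩ := (FiniteMultiplicity.of_not_isUnit hzprime.not_isUnit
    hf0).exists_eq_pow_mul_and_not_dvd
  generalize multiplicity z f = k at hfk
  have hord : ∀ n, f ∈ maximalIdeal R ^ n → n ≤ m := fun n hn =>
    hm ▸ not_mem_of_ordRes u f hfu n hn
  have hkm : k ≤ m := by
    apply hord
    rw [hfk]
    exact Ideal.mul_mem_right _ _ (Ideal.pow_mem_pow hzM k)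
  have hg : cmpl g = δ * c ^ m * cmpl z ^ (m - k) := by
    apply hzreg.pow k
    change cmpl z ^ k * cmpl g = cmpl z ^ k * (δ * c ^ m * cmpl z ^ (m - k))
    have h1 : cmpl z ^ m = cmpl z ^ k * cmpl z ^ (m - k) := by
      rw [← pow_add, Nat.add_sub_cancel' hkm]
    rw [← map_pow, ← map_mul, ← hfk, hfac, hc, mul_pow, h1, map_pow]
    ring
  have hkm' : k = m := by
    by_contra hne
    apply hzg
    rw [← Ideal.mem_span_singleton]
    apply mem_span_of_cmpl
    rw [hg, Ideal.mem_span_singleton]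
    exact (dvd_pow_self _ (by omega)).mul_left _
  subst hkm'
  have hgu : IsUnit g := by
    by_contra hgn
    have : k + 1 ≤ k := by
      apply hord
      rw [hfk, pow_succ]
      exact Ideal.mul_mem_mul (Ideal.pow_mem_pow hzM k) hgn
    omega
  have hk0 : k ≠ 0 := by
    rintro rfl
    rw [pow_zero, one_mul] at hfk
    rw [hfk] at hfM
    exact hfM hgu
  have hcu : IsUnit c := by
    have h1 : IsUnit (cmpl g) := hgu.map cmpl
    rw [hg, Nat.sub_self, pow_zero, mul_one] at h1
    exact (isUnit_pow_iff hk0).mp (isUnit_of_mul_isUnit_right h1)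
  have hfz : Ideal.span {f} = Ideal.span {z} ^ k := by
    rw [Ideal.span_singleton_pow, hfk]
    exact Ideal.span_singleton_mul_right_unit hgu _
  refine ⟨z, hzP, ?_, ?_, hfz, ?_, hdim⟩
  · rw [hfz, Ideal.radical_pow _ hk0, hzP.radical]
  · rw [hc]
    exact (Ideal.span_singleton_mul_right_unit hcu _).symm
  · rw [hcons]; exact hzs

end CharPolyhedra
end
end
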